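/- Let λ be a Lévy measure on (0,∞) satisfying Condition (E), and suppose λ̄(r) = ℓ(r) for all r ≥ 1, where ℓ is slowly varying. Define L₀(r) = ∫_1^∞ ℓ(ry) y^{-1} (log y)^{d/2−1} dy. Then L₀(r) is finite for r ≥ 1, L₀ is slowly varying, L₀(r)/ℓ(r) → ∞ as r → ∞, and η̄(r) ~ L₀(r) · D^{1+2/d} / (2πκ Γ(d/2 + 1)(1 + 2/d)) as r → ∞, where Γ is the Gamma function. -/

import Mathlib

open MeasureTheory Real Filter Set
open scoped ENNReal Topology

noncomputable section

/-- The heat kernel on `ℝ^d` with diffusion constant `κ`. -/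
def heatKernel (d : ℕ) (κ : ℝ) (s : ℝ) (x : EuclideanSpace ℝ (Fin d)) : ℝ :=
  (2 * π * κ * s) ^ (-(d : ℝ) / 2) * Real.exp (-‖x‖ ^ 2 / (2 * κ * s))

/-- A Lévy measure on `(0,∞)`: a nonzero Borel measure carried by `(0,∞)`
with `∫ min(1, z²) λ(dz) < ∞`. -/
def IsLevyMeasure (lam : Measure ℝ) : Prop :=
  lam ≠ 0 ∧ lam (Set.Iic 0) = 0 ∧
    ∫⁻ z in Set.Ioi (0 : ℝ), ENNReal.ofReal (min 1 (z ^ 2)) ∂lam < ⊤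

/-- `η̄(r) = (Leb ⊗ Leb ⊗ λ)({(s,y,z) ∈ (0,t] × ℝ^d × (0,∞) : g(s,y) z > r})`. -/
def etaBar (d : ℕ) (κ t : ℝ) (lam : Measure ℝ) (r : ℝ) : ℝ≥0∞ :=
  (volume.prod (volume.prod lam))
    {p : ℝ × (EuclideanSpace ℝ (Fin d)) × ℝ |
      p.1 ∈ Set.Ioc (0 : ℝ) t ∧ p.2.2 ∈ Set.Ioi (0 : ℝ) ∧
        r < heatKernel d κ p.1 p.2.1 * p.2.2}

/-- `η̄₀(r)`, the analogue of `η̄` with the restriction `|y| ≤ 1/2`. -/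
def etaBar0 (d : ℕ) (κ t : ℝ) (lam : Measure ℝ) (r : ℝ) : ℝ≥0∞ :=
  (volume.prod (volume.prod lam))
    {p : ℝ × (EuclideanSpace ℝ (Fin d)) × ℝ |
      p.1 ∈ Set.Ioc (0 : ℝ) t ∧ p.2.2 ∈ Set.Ioi (0 : ℝ) ∧ ‖p.2.1‖ ≤ 1 / 2 ∧
        r < heatKernel d κ p.1 p.2.1 * p.2.2}

/-- `η̄_A(r)`, where the heat kernel is evaluated at `dist(y, A)`. -/
def etaBarA (d : ℕ) (κ t : ℝ) (lam : Measure ℝ)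
    (A : Set (EuclideanSpace ℝ (Fin d))) (r : ℝ) : ℝ≥0∞ :=
  (volume.prod (volume.prod lam))
    {p : ℝ × (EuclideanSpace ℝ (Fin d)) × ℝ |
      p.1 ∈ Set.Ioc (0 : ℝ) t ∧ p.2.2 ∈ Set.Ioi (0 : ℝ) ∧
        r < (2 * π * κ * p.1) ^ (-(d : ℝ) / 2) *
            Real.exp (-(Metric.infDist p.2.1 A) ^ 2 / (2 * κ * p.1)) * p.2.2}

/-- `τ̄(r) = (Leb ⊗ λ)({(s,z) ∈ (0,t] × (0,∞) : (2πκs)^{-d/2} z > r})`. -/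
def tauBar (d : ℕ) (κ t : ℝ) (lam : Measure ℝ) (r : ℝ) : ℝ≥0∞ :=
  (volume.prod lam)
    {p : ℝ × ℝ | p.1 ∈ Set.Ioc (0 : ℝ) t ∧ p.2 ∈ Set.Ioi (0 : ℝ) ∧
      r < (2 * π * κ * p.1) ^ (-(d : ℝ) / 2) * p.2}

/-- The truncated moment `M_γ(x) = ∫_{(0,x]} z^γ λ(dz)`. -/
def Mgamma (lam : Measure ℝ) (γ x : ℝ) : ℝ≥0∞ :=
  ∫⁻ z in Set.Ioc (0 : ℝ) x, ENNReal.ofReal (z ^ γ) ∂lam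

/-- A measurable function, positive on `[1,∞)`, is slowly varying at infinity if
`ℓ(cx)/ℓ(x) → 1` as `x → ∞` for every `c > 0`. -/
def SlowlyVarying (ℓ : ℝ → ℝ) : Prop :=
  Measurable ℓ ∧ (∀ x ≥ (1 : ℝ), 0 < ℓ x) ∧
    ∀ c > (0 : ℝ), Tendsto (fun x => ℓ (c * x) / ℓ x) atTop (𝓝 1)

/-- Regular variation at infinity with index `-α`: `f` is eventually positive and
`f(cr)/f(r) → c^{-α}` as `r → ∞` for every `c > 0`. -/
def RegVaryNeg (f : ℝ → ℝ) (α : ℝ) : Prop :=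
  (∀ᶠ r in atTop, 0 < f r) ∧
    ∀ c > (0 : ℝ), Tendsto (fun r => f (c * r) / f r) atTop (𝓝 (c ^ (-α)))

/-- Condition (E): the necessary and sufficient condition for existence of the solution. -/
def ConditionE (d : ℕ) (lam : Measure ℝ) : Prop :=
  (∫⁻ z in Set.Ioi (1 : ℝ), ENNReal.ofReal (Real.log z ^ ((d : ℝ) / 2)) ∂lam < ⊤) ∧
  (d = 1 → ∫⁻ z in Set.Ioc (0 : ℝ) 1, ENNReal.ofReal (z ^ 2) ∂lam < ⊤) ∧
  (d = 2 → ∫⁻ z in Set.Ioc (0 : ℝ) 1, ENNReal.ofReal (z ^ 2 * |Real.log z|) ∂lam < ⊤) ∧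
  (3 ≤ d → ∫⁻ z in Set.Ioc (0 : ℝ) 1, ENNReal.ofReal (z ^ (1 + 2 / (d : ℝ))) ∂lam < ⊤)

/-- Condition (F): `∫_{(0,1)} z^{2/d} λ(dz) < ∞` if `d ≠ 2`,
and `∫_{(0,1)} z |log z| λ(dz) < ∞` if `d = 2`. -/
def ConditionF (d : ℕ) (lam : Measure ℝ) : Prop :=
  (d ≠ 2 → ∫⁻ z in Set.Ioo (0 : ℝ) 1, ENNReal.ofReal (z ^ ((2 : ℝ) / d)) ∂lam < ⊤) ∧
  (d = 2 → ∫⁻ z in Set.Ioo (0 : ℝ) 1, ENNReal.ofReal (z * |Real.log z|) ∂lam < ⊤)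

/-- The truncated logarithmic moment `∫_{(0,∞)} (log⁺ (z / a))^p λ(dz)`. -/
def logMoment (lam : Measure ℝ) (p a : ℝ) : ℝ≥0∞ :=
  ∫⁻ z in Ioi (0 : ℝ), ENNReal.ofReal (max 0 (Real.log (z / a)) ^ p) ∂lam

theorem IsLevyMeasure.measure_Ioi_lt_top {lam : Measure ℝ} (h : IsLevyMeasure lam) {ε : ℝ}
    (hε : 0 < ε) : lam (Ioi ε) < ⊤ := by
  have hm : 0 < min 1 (ε ^ 2) := by positivity
  have h1 : ENNReal.ofReal (min 1 (ε ^ 2)) * lam (Ioi ε) ≤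
      ∫⁻ z in Ioi (0 : ℝ), ENNReal.ofReal (min 1 (z ^ 2)) ∂lam := by
    rw [← setLIntegral_const]
    refine (setLIntegral_mono (by fun_prop) fun z hz => ?_).trans
      (lintegral_mono_set (Ioi_subset_Ioi hε.le))
    have hz' : ε < z := hz
    gcongr
  refine ENNReal.lt_top_of_mul_ne_top_right (h1.trans_lt h.2.2).ne ?_
  exact (ENNReal.ofReal_pos.2 hm).ne'

theorem IsLevyMeasure.sigmaFinite {lam : Measure ℝ} (h : IsLevyMeasure lam) :
    SigmaFinite lam := by
  refine ⟨⟨⟨fun n => Iic 0 ∪ Ioi (1 / ((n : ℝ) + 1)), fun _ => trivial, fun n => ?_, ?_⟩⟩⟩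
  · refine (measure_union_le _ _).trans_lt ?_
    rw [h.2.1, zero_add]
    exact h.measure_Ioi_lt_top (by positivity)
  · refine eq_univ_of_forall fun x => ?_
    rcases le_or_gt x 0 with hx | hx
    · exact mem_iUnion.2 ⟨0, Or.inl hx⟩
    · obtain ⟨n, hn⟩ := exists_nat_one_div_lt hx
      exact mem_iUnion.2 ⟨n, Or.inr hn⟩

theorem logMoment_le_of_le (lam : Measure ℝ) {p a b : ℝ} (hp : 0 ≤ p) (ha : 0 < a)
    (hab : a ≤ b) : logMoment lam p b ≤ logMoment lam p a := by
  refine setLIntegral_mono' measurableSet_Ioi fun z hz => ENNReal.ofReal_le_ofReal ?_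
  have hz' : 0 < z := hz
  have hb : 0 < b := ha.trans_le hab
  gcongr

theorem logMoment_eq_lintegral_tail (lam : Measure ℝ) {p a : ℝ} (hp : 0 < p) (ha : 0 < a) :
    logMoment lam p a = ENNReal.ofReal p *
      ∫⁻ x in Ioi (0 : ℝ), lam (Ioi (a * Real.exp x)) * ENNReal.ofReal (x ^ (p - 1)) := by
  rw [logMoment, lintegral_rpow_eq_lintegral_meas_lt_mul (f := fun z => max 0 (Real.log (z / a)))
    _ (ae_of_all _ fun z => le_max_left _ _)
    (Measurable.aemeasurable (by fun_prop)) hp]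
  congr 1
  refine setLIntegral_congr_fun measurableSet_Ioi fun x hx => ?_
  have hx' : 0 < x := hx
  have hset : {z : ℝ | x < max 0 (Real.log (z / a))} ∩ Ioi 0 = Ioi (a * Real.exp x) := by
    ext z
    simp only [mem_inter_iff, mem_ofPred_eq, mem_Ioi, lt_max_iff, hx'.not_gt, false_or]
    constructor
    · rintro ⟨h1, h2⟩
      rwa [Real.lt_log_iff_exp_lt (by positivity), lt_div_iff₀' ha] at h1
    · intro h
      have hz : 0 < z := lt_trans (by positivity) h
      exact ⟨by rwa [Real.lt_log_iff_exp_lt (by positivity), lt_div_iff₀' ha], hz⟩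
  rw [Measure.restrict_apply (measurableSet_lt (by fun_prop) (by fun_prop)), hset]

theorem mul_measure_Ioi_le_logMoment (lam : Measure ℝ) {p a M : ℝ} (hp : 0 ≤ p) (ha : 0 < a)
    (hM : 1 ≤ M) :
    ENNReal.ofReal (Real.log M ^ p) * lam (Ioi (a * M)) ≤ logMoment lam p a := by
  rw [← setLIntegral_const]
  have h0 : (0 : ℝ) ≤ a * M := by positivity
  refine (setLIntegral_mono' measurableSet_Ioi fun z hz => ?_).trans
    (lintegral_mono_set (Ioi_subset_Ioi h0))
  have hz' : a * M < z := hz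
  refine ENNReal.ofReal_le_ofReal (Real.rpow_le_rpow (Real.log_nonneg hM) ?_ hp)
  refine le_max_of_le_right (Real.log_le_log (by positivity) ?_)
  rw [le_div_iff₀' ha]
  exact hz'.le

theorem logMoment_one_lt_top {d : ℕ} {lam : Measure ℝ} (hd : 1 ≤ d) (hE : ConditionE d lam) :
    logMoment lam ((d : ℝ) / 2) 1 < ⊤ := by
  have hp : (d : ℝ) / 2 ≠ 0 := by positivity
  refine lt_of_le_of_lt ?_ hE.1
  rw [logMoment, ← Ioc_union_Ioi_eq_Ioi (zero_le_one (α := ℝ))]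
  refine (lintegral_union_le _ _ _).trans ?_
  have h1 : ∫⁻ z in Ioc (0 : ℝ) 1,
      ENNReal.ofReal (max 0 (Real.log (z / 1)) ^ ((d : ℝ) / 2)) ∂lam = 0 := by
    rw [setLIntegral_congr_fun (g := fun _ => 0) measurableSet_Ioc, lintegral_zero]
    intro z hz
    have : Real.log z ≤ 0 := Real.log_nonpos hz.1.le hz.2
    simp [this, hp]
  rw [h1, zero_add]
  refine setLIntegral_mono' measurableSet_Ioi fun z hz => le_of_eq ?_
  have : 0 ≤ Real.log z := Real.log_nonneg (le_of_lt hz)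
  simp [this]

theorem measurable_logMoment (lam : Measure ℝ) [SFinite lam] (p : ℝ) :
    Measurable (logMoment lam p) := by
  unfold logMoment
  refine Measurable.lintegral_prod_right' (f := fun q : ℝ × ℝ =>
    ENNReal.ofReal (max 0 (Real.log (q.2 / q.1)) ^ p)) ?_
  fun_prop

theorem volume_heatKernel_superlevel {d : ℕ} (hd : 1 ≤ d) {κ s r z : ℝ} (hκ : 0 < κ) (hs : 0 < s)
    (hr : 0 < r) (hz : 0 < z) :
    volume {y : EuclideanSpace ℝ (Fin d) | r < heatKernel d κ s y * z} =
      ENNReal.ofReal ((2 * π * κ * s) ^ ((d : ℝ) / 2) / Real.Gamma ((d : ℝ) / 2 + 1)) *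
        ENNReal.ofReal
          (max 0 (Real.log (z / (r * (2 * π * κ * s) ^ ((d : ℝ) / 2)))) ^ ((d : ℝ) / 2)) := by
  have hb : 0 < 2 * π * κ * s := by positivity
  set u := (2 * π * κ * s) ^ ((d : ℝ) / 2) with hu_def
  have hu : 0 < u := by positivity
  set L := max 0 (Real.log (z / (r * u))) with hL_def
  have hL : 0 ≤ L := le_max_left _ _
  have hset : {y : EuclideanSpace ℝ (Fin d) | r < heatKernel d κ s y * z} =
      Metric.ball 0 (√(2 * κ * s * L)) := by
    ext y
    have hneg : (2 * π * κ * s) ^ (-(d : ℝ) / 2) = u⁻¹ := by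
      rw [neg_div, Real.rpow_neg hb.le]
    rw [mem_ofPred_eq, mem_ball_zero_iff, Real.lt_sqrt (norm_nonneg _), ← div_lt_iff₀'
      (by positivity : 0 < 2 * κ * s), hL_def, lt_max_iff,
      or_iff_right (not_lt.2 (by positivity)), Real.lt_log_iff_exp_lt (by positivity),
      lt_div_iff₀' (by positivity), heatKernel, hneg, neg_div, Real.exp_neg]
    have he := Real.exp_pos (‖y‖ ^ 2 / (2 * κ * s))
    rw [← mul_inv, inv_mul_eq_div, lt_div_iff₀ (by positivity), ← mul_assoc]
  have : Nonempty (Fin d) := Fin.pos_iff_nonempty.1 hd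
  have hG : 0 < Real.Gamma ((d : ℝ) / 2 + 1) := Real.Gamma_pos_of_pos (by positivity)
  have hsqrt : ∀ x : ℝ, 0 ≤ x → √x ^ d = x ^ ((d : ℝ) / 2) := by
    intro x hx
    rw [Real.sqrt_eq_rpow, ← Real.rpow_natCast, ← Real.rpow_mul hx]
    congr 1
    ring
  rw [hset, EuclideanSpace.volume_ball, Fintype.card_fin, ← ENNReal.ofReal_pow (Real.sqrt_nonneg _),
    ← ENNReal.ofReal_mul (by positivity), ← ENNReal.ofReal_mul (by positivity),
    hsqrt _ (by positivity), hsqrt _ pi_pos.le]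
  congr 1
  rw [hu_def, div_mul_eq_mul_div, ← mul_div_assoc, ← Real.mul_rpow (by positivity) (by positivity),
    ← Real.mul_rpow (by positivity) (by positivity)]
  congr 2
  ring

theorem etaBar_eq {d : ℕ} (hd : 1 ≤ d) {κ t r : ℝ} (hκ : 0 < κ) (hr : 0 < r) (lam : Measure ℝ)
    [SFinite lam] :
    etaBar d κ t lam r = ENNReal.ofReal (1 / Real.Gamma ((d : ℝ) / 2 + 1)) *
      ∫⁻ s in Ioc 0 t, ENNReal.ofReal ((2 * π * κ * s) ^ ((d : ℝ) / 2)) *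
        logMoment lam ((d : ℝ) / 2) (r * (2 * π * κ * s) ^ ((d : ℝ) / 2)) := by
  have hG : 0 < Real.Gamma ((d : ℝ) / 2 + 1) := Real.Gamma_pos_of_pos (by positivity)
  have hmeas : MeasurableSet {p : ℝ × (EuclideanSpace ℝ (Fin d)) × ℝ |
      p.1 ∈ Ioc (0 : ℝ) t ∧ p.2.2 ∈ Ioi (0 : ℝ) ∧ r < heatKernel d κ p.1 p.2.1 * p.2.2} := by
    refine (measurable_fst measurableSet_Ioc).inter
      (((measurable_snd.comp measurable_snd) measurableSet_Ioi).inter ?_)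
    unfold heatKernel
    exact measurableSet_lt (f := fun _ => r)
      (g := fun q : ℝ × (EuclideanSpace ℝ (Fin d)) × ℝ => (2 * π * κ * q.1) ^ (-(d : ℝ) / 2) *
        Real.exp (-‖q.2.1‖ ^ 2 / (2 * κ * q.1)) * q.2.2) (by fun_prop) (by fun_prop)
  rw [etaBar, Measure.prod_apply hmeas, ← lintegral_const_mul' _ _ ENNReal.ofReal_ne_top,
    ← lintegral_indicator measurableSet_Ioc]
  refine lintegral_congr fun s => ?_
  by_cases hs : s ∈ Ioc 0 t
  · rw [indicator_of_mem hs, Measure.prod_apply_symm (measurable_prodMk_left hmeas), logMoment,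
      ← mul_assoc, ← ENNReal.ofReal_mul (by positivity), ← lintegral_const_mul' _ _
      ENNReal.ofReal_ne_top, ← lintegral_indicator measurableSet_Ioi]
    refine lintegral_congr fun z => ?_
    by_cases hz : z ∈ Ioi (0 : ℝ)
    · rw [indicator_of_mem hz, one_div_mul_eq_div,
        ← volume_heatKernel_superlevel hd hκ hs.1 hr hz]
      congr 1
      ext y
      simp only [mem_preimage, mem_ofPred_eq]
      tauto
    · rw [indicator_of_notMem hz]
      refine (congrArg _ ?_).trans measure_empty
      ext y
      simp only [mem_preimage, mem_ofPred_eq, mem_empty_iff_false]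
      tauto
  · rw [indicator_of_notMem hs]
    refine (congrArg _ ?_).trans measure_empty
    ext y
    simp only [mem_preimage, mem_ofPred_eq, mem_empty_iff_false]
    tauto

theorem max_zero_log_rpow_le {p x : ℝ} (hp : 0 < p) (hx : 0 < x) :
    max 0 (Real.log x) ^ p ≤ p ^ p * x := by
  have h1 : max 0 (Real.log x) ≤ p * x ^ (1 / p) := by
    refine max_le (by positivity) ?_
    have := Real.log_le_rpow_div hx.le (one_div_pos.2 hp)
    rwa [div_div_eq_mul_div, div_one, mul_comm] at this
  calc max 0 (Real.log x) ^ p ≤ (p * x ^ (1 / p)) ^ p := by gcongr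
    _ = p ^ p * x := by
      rw [Real.mul_rpow hp.le (by positivity), ← Real.rpow_mul hx.le, one_div_mul_cancel hp.ne',
        Real.rpow_one]

theorem mul_max_zero_log_div_rpow_le {p u z : ℝ} (hp : 0 < p) (hu : 0 < u) (hz : 0 < z) :
    u * max 0 (Real.log (z / u)) ^ p ≤ p ^ p * z :=
  calc u * max 0 (Real.log (z / u)) ^ p ≤ u * (p ^ p * (z / u)) := by
        gcongr
        exact max_zero_log_rpow_le hp (by positivity)
    _ = p ^ p * z := by field_simp

theorem lintegral_mul_log_div_rpow_le {c p z S : ℝ} (hc : 0 < c) (hp : 0 < p) (hz : 0 < z) :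
    ∫⁻ s in Ioc 0 S, ENNReal.ofReal ((c * s) ^ p * max 0 (Real.log (z / (c * s) ^ p)) ^ p) ≤
      ENNReal.ofReal (p ^ p / c) * ENNReal.ofReal (z ^ (1 + 1 / p)) := by
  have hle : ∀ s ∈ Ioc 0 S,
      ENNReal.ofReal ((c * s) ^ p * max 0 (Real.log (z / (c * s) ^ p)) ^ p) ≤
        (Ioc 0 (z ^ (1 / p) / c)).indicator (fun _ => ENNReal.ofReal (p ^ p * z)) s := by
    intro s hs
    have hs0 : 0 < s := hs.1
    have hu : 0 < (c * s) ^ p := by positivity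
    by_cases hsz : s ≤ z ^ (1 / p) / c
    · rw [indicator_of_mem (mem_Ioc.2 ⟨hs0, hsz⟩)]
      exact ENNReal.ofReal_le_ofReal (mul_max_zero_log_div_rpow_le hp hu hz)
    · rw [not_le, div_lt_iff₀' hc] at hsz
      have h1 : z ≤ (c * s) ^ p := by
        have h2 := Real.rpow_le_rpow (by positivity) hsz.le hp.le
        rwa [← Real.rpow_mul hz.le, one_div_mul_cancel hp.ne', Real.rpow_one] at h2
      have h3 : Real.log (z / (c * s) ^ p) ≤ 0 :=
        Real.log_nonpos (by positivity) ((div_le_one hu).2 h1)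
      rw [max_eq_left h3, Real.zero_rpow hp.ne', mul_zero, ENNReal.ofReal_zero]
      exact zero_le
  calc _ ≤ ∫⁻ s in Ioc 0 S,
        (Ioc 0 (z ^ (1 / p) / c)).indicator (fun _ => ENNReal.ofReal (p ^ p * z)) s :=
        setLIntegral_mono' measurableSet_Ioc hle
    _ ≤ ∫⁻ s, (Ioc 0 (z ^ (1 / p) / c)).indicator (fun _ => ENNReal.ofReal (p ^ p * z)) s :=
        setLIntegral_le_lintegral _ _
    _ = ENNReal.ofReal (p ^ p / c) * ENNReal.ofReal (z ^ (1 + 1 / p)) := by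
        rw [lintegral_indicator measurableSet_Ioc, setLIntegral_const, Real.volume_Ioc, sub_zero,
          ← ENNReal.ofReal_mul (by positivity), ← ENNReal.ofReal_mul (by positivity),
          Real.rpow_add hz, Real.rpow_one]
        congr 1
        ring

theorem mul_log_div_rpow_le {p u U z : ℝ} (hp : 0 < p) (hu : 0 < u) (huU : u ≤ U) (hz : 1 < z) :
    u * max 0 (Real.log (z / u)) ^ p ≤ 2 ^ p * (U * Real.log z ^ p + p ^ p) := by
  have hlz : 0 ≤ Real.log z := Real.log_nonneg hz.le
  have h1 : max 0 (Real.log (z / u)) ≤ 2 * max (Real.log z) (max 0 (Real.log (1 / u))) := by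
    rw [Real.log_div (by positivity) hu.ne', one_div, Real.log_inv]
    refine max_le (by positivity) ?_
    have h2 := le_max_left (Real.log z) (max 0 (-Real.log u))
    have h3 := (le_max_right 0 (-Real.log u)).trans
      (le_max_right (Real.log z) (max 0 (-Real.log u)))
    linarith
  have h4 : max (Real.log z) (max 0 (Real.log (1 / u))) ^ p ≤
      Real.log z ^ p + max 0 (Real.log (1 / u)) ^ p := by
    rcases max_cases (Real.log z) (max 0 (Real.log (1 / u))) with h | h
    · rw [h.1]
      exact le_add_of_nonneg_right (by positivity)
    · rw [h.1]
      exact le_add_of_nonneg_left (by positivity)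
  have h5 := mul_max_zero_log_div_rpow_le hp hu one_pos
  calc u * max 0 (Real.log (z / u)) ^ p
      ≤ u * (2 * max (Real.log z) (max 0 (Real.log (1 / u)))) ^ p := by gcongr
    _ = 2 ^ p * (u * max (Real.log z) (max 0 (Real.log (1 / u))) ^ p) := by
        rw [Real.mul_rpow (by positivity) (by positivity)]
        ring
    _ ≤ 2 ^ p * (u * (Real.log z ^ p + max 0 (Real.log (1 / u)) ^ p)) := by gcongr
    _ ≤ 2 ^ p * (U * Real.log z ^ p + p ^ p) := by
        rw [mul_add]
        gcongr
        simpa using h5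

theorem lintegral_mul_logMoment_lt_top {lam : Measure ℝ} [SFinite lam] {c p : ℝ} (hc : 0 < c)
    (hp : 0 < p) (hsmall : ∫⁻ z in Ioc (0 : ℝ) 1, ENNReal.ofReal (z ^ (1 + 1 / p)) ∂lam < ⊤)
    (hlarge : ∫⁻ z in Ioi (1 : ℝ), ENNReal.ofReal (Real.log z ^ p) ∂lam < ⊤)
    (htail : lam (Ioi 1) < ⊤) (S : ℝ) :
    ∫⁻ s in Ioc 0 S, ENNReal.ofReal ((c * s) ^ p) * logMoment lam p ((c * s) ^ p) < ⊤ := by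
  have hswap : ∫⁻ s in Ioc 0 S, ENNReal.ofReal ((c * s) ^ p) * logMoment lam p ((c * s) ^ p) =
      ∫⁻ z in Ioi (0 : ℝ), ∫⁻ s in Ioc 0 S,
        ENNReal.ofReal ((c * s) ^ p * max 0 (Real.log (z / (c * s) ^ p)) ^ p) ∂volume ∂lam := by
    rw [lintegral_lintegral_swap (Measurable.aemeasurable (by fun_prop))]
    refine setLIntegral_congr_fun measurableSet_Ioc fun s hs => ?_
    have hs0 : 0 < s := hs.1
    simp only [logMoment]
    rw [← lintegral_const_mul' _ _ ENNReal.ofReal_ne_top]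
    refine lintegral_congr fun z => ?_
    rw [ENNReal.ofReal_mul (by positivity)]
  rw [hswap, ← Ioc_union_Ioi_eq_Ioi (zero_le_one (α := ℝ))]
  refine (lintegral_union_le _ _ _).trans_lt (ENNReal.add_lt_top.2 ⟨?_, ?_⟩)
  · refine (setLIntegral_mono' measurableSet_Ioc fun z hz =>
      lintegral_mul_log_div_rpow_le hc hp hz.1).trans_lt ?_
    rw [lintegral_const_mul' _ _ ENNReal.ofReal_ne_top]
    exact ENNReal.mul_lt_top ENNReal.ofReal_lt_top hsmall
  · have hle : ∀ z ∈ Ioi (1 : ℝ), ∫⁻ s in Ioc 0 S,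
        ENNReal.ofReal ((c * s) ^ p * max 0 (Real.log (z / (c * s) ^ p)) ^ p) ≤
        ENNReal.ofReal (2 ^ p * (c * S) ^ p) * ENNReal.ofReal S * ENNReal.ofReal (Real.log z ^ p) +
          ENNReal.ofReal (2 ^ p * p ^ p) * ENNReal.ofReal S := by
      intro z hz
      have hlz : 0 ≤ Real.log z := Real.log_nonneg (le_of_lt hz)
      rcases le_or_gt S 0 with hS | hS
      · rw [Ioc_eq_empty (not_lt.2 hS)]
        simp
      refine (setLIntegral_mono' (g := fun _ => ENNReal.ofReal (2 ^ p * ((c * S) ^ p *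
        Real.log z ^ p + p ^ p))) measurableSet_Ioc fun s hs => ?_).trans (le_of_eq ?_)
      · have hs0 : 0 < s := hs.1
        have hsS : s ≤ S := hs.2
        exact ENNReal.ofReal_le_ofReal (mul_log_div_rpow_le hp (by positivity) (by gcongr) hz)
      · rw [setLIntegral_const, Real.volume_Ioc, sub_zero, mul_right_comm, ← add_mul,
          ← ENNReal.ofReal_mul (p := 2 ^ p * (c * S) ^ p) (by positivity),
          ← ENNReal.ofReal_add (by positivity) (by positivity),
          ← ENNReal.ofReal_mul (by positivity), ← ENNReal.ofReal_mul (by positivity)]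
        congr 2
        ring
    refine (setLIntegral_mono' measurableSet_Ioi hle).trans_lt ?_
    rw [lintegral_add_right _ measurable_const, lintegral_const_mul' _ _ (by finiteness),
      setLIntegral_const]
    finiteness

theorem le_two_mul_div_mul_of_le_two_mul {φ : ℝ → ℝ} {X : ℝ} (hX : 0 < X)
    (hnonneg : ∀ x, 0 ≤ φ x) (hanti : ∀ x y, X ≤ x → x ≤ y → φ y ≤ φ x)
    (hdouble : ∀ x, X ≤ x → φ x ≤ 2 * φ (2 * x)) {x y : ℝ} (hx : X ≤ x) (hxy : x ≤ y) :
    φ x ≤ 2 * (y / x) * φ y := by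
  have hx0 : 0 < x := hX.trans_le hx
  have hiter : ∀ n : ℕ, φ x ≤ 2 ^ n * φ (2 ^ n * x) := by
    intro n
    induction n with
    | zero => simp
    | succ n ih =>
      have hle : X ≤ 2 ^ n * x := hx.trans (le_mul_of_one_le_left hx0.le (one_le_pow₀ one_le_two))
      calc φ x ≤ 2 ^ n * φ (2 ^ n * x) := ih
        _ ≤ 2 ^ n * (2 * φ (2 * (2 ^ n * x))) := by
          gcongr
          exact hdouble _ hle
        _ = 2 ^ (n + 1) * φ (2 ^ (n + 1) * x) := by
          rw [← mul_assoc, ← mul_assoc, pow_succ, mul_comm (2 : ℝ) (2 ^ n)]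
  obtain ⟨n, hn1, hn2⟩ := exists_nat_pow_near ((one_le_div hx0).2 hxy) (one_lt_two (α := ℝ))
  have hy : y ≤ 2 ^ (n + 1) * x := ((div_lt_iff₀ hx0).1 hn2).le
  have hxy0 : 0 ≤ y / x := div_nonneg (hx0.le.trans hxy) hx0.le
  calc φ x ≤ 2 ^ (n + 1) * φ (2 ^ (n + 1) * x) := hiter _
    _ ≤ 2 ^ (n + 1) * φ y := by
      gcongr
      exact hanti _ _ (hx.trans hxy) hy
    _ ≤ 2 * (y / x) * φ y := by
      rw [pow_succ, mul_comm _ (2 : ℝ)]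
      gcongr
      exact hnonneg y

theorem lintegral_Ioc_zero_mul_left (g : ℝ → ℝ≥0∞) {k : ℝ} (hk : 0 < k) (S : ℝ) :
    ∫⁻ s in Ioc 0 (k * S), g s = ENNReal.ofReal k * ∫⁻ s in Ioc 0 S, g (k * s) := by
  have himage : (fun s => k * s) '' Ioc 0 S = Ioc 0 (k * S) := by
    rw [image_mul_left_Ioc hk, mul_zero]
  rw [← himage, lintegral_image_eq_lintegral_abs_deriv_mul (f' := fun _ => k) measurableSet_Ioc
    (fun s _ => by simpa using ((hasDerivAt_id s).const_mul k).hasDerivWithinAt)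
    (mul_right_injective₀ hk.ne').injOn, abs_of_pos hk, lintegral_const_mul' _ _
    ENNReal.ofReal_ne_top]

/-- A Karamata-type theorem: a nonincreasing slowly varying function may be pulled out of an
integral against a power weight. -/
theorem tendsto_lintegral_rpow_mul_div {F : ℝ → ℝ≥0∞} {c p t : ℝ} (hc : 0 < c) (hp : 0 < p)
    (hF : Measurable F) (hanti : ∀ a b, 0 < a → a ≤ b → F b ≤ F a)
    (htop : F 1 < ⊤) (hpos : ∀ x, 1 ≤ x → F x ≠ 0)
    (hsv : ∀ k > (0 : ℝ), Tendsto (fun x => (F (k * x)).toReal / (F x).toReal) atTop (𝓝 1))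
    (hint : ∀ S, ∫⁻ s in Ioc 0 S, ENNReal.ofReal ((c * s) ^ p) * F ((c * s) ^ p) < ⊤) :
    Tendsto (fun r => (∫⁻ s in Ioc 0 t, ENNReal.ofReal ((c * s) ^ p) * F (r * (c * s) ^ p)) / F r)
      atTop (𝓝 (∫⁻ s in Ioc 0 t, ENNReal.ofReal ((c * s) ^ p))) := by
  have hfin : ∀ x, 1 ≤ x → F x ≠ ⊤ := fun x hx => ((hanti 1 x one_pos hx).trans_lt htop).ne
  have hφpos : ∀ x, 1 ≤ x → 0 < (F x).toReal := fun x hx =>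
    ENNReal.toReal_pos (hpos x hx) (hfin x hx)
  obtain ⟨X, hX1, hX⟩ : ∃ X : ℝ, 1 ≤ X ∧ ∀ x, X ≤ x → (F x).toReal ≤ 2 * (F (2 * x)).toReal := by
    obtain ⟨X, hX⟩ := eventually_atTop.1
      ((hsv 2 two_pos).eventually (lt_mem_nhds (by norm_num : (1 / 2 : ℝ) < 1)))
    refine ⟨max 1 X, le_max_left _ _, fun x hx => ?_⟩
    have h1 := hX x ((le_max_right _ _).trans hx)
    rw [lt_div_iff₀ (hφpos x ((le_max_left _ _).trans hx))] at h1
    linarith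
  have hX0 : 0 < X := one_pos.trans_le hX1
  have hpotter : ∀ x y, X ≤ x → x ≤ y → (F x).toReal ≤ 2 * (y / x) * (F y).toReal :=
    fun x y hx hxy => le_two_mul_div_mul_of_le_two_mul hX0 (fun _ => ENNReal.toReal_nonneg)
      (fun a b ha hab => ENNReal.toReal_mono (hfin a (hX1.trans ha))
        (hanti a b (hX0.trans_le ha) hab)) hX hx hxy
  -- Split the time interval according to whether `r * (c * s) ^ p` is smaller than `X`.
  set B : ℝ → Set ℝ := fun r => {s | X ≤ r * (c * s) ^ p} with hB_def
  have hB : ∀ r, MeasurableSet (B r) := fun r => measurableSet_le (by fun_prop) (by fun_prop)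
  have hsplit : ∀ r, (∫⁻ s in Ioc 0 t, ENNReal.ofReal ((c * s) ^ p) * F (r * (c * s) ^ p)) / F r =
      (∫⁻ s in Ioc 0 t, (B r).indicator
        (fun s => ENNReal.ofReal ((c * s) ^ p) * (F (r * (c * s) ^ p) / F r)) s) +
      (∫⁻ s in Ioc 0 t \ B r, ENNReal.ofReal ((c * s) ^ p) * F (r * (c * s) ^ p)) / F r := by
    intro r
    rw [← lintegral_inter_add_sdiff _ (Ioc 0 t) (hB r), ENNReal.add_div]
    congr 1
    rw [setLIntegral_indicator (hB r), inter_comm, ENNReal.div_eq_inv_mul,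
      ← lintegral_const_mul _ (by fun_prop)]
    refine lintegral_congr fun s => ?_
    rw [ENNReal.div_eq_inv_mul]
    ring
  have hsmall : Tendsto (fun r => (∫⁻ s in Ioc 0 t \ B r,
      ENNReal.ofReal ((c * s) ^ p) * F (r * (c * s) ^ p)) / F r) atTop (𝓝 0) := by
    set S := X ^ (1 / p) / c with hS_def
    set C := ∫⁻ s in Ioc 0 S, ENNReal.ofReal ((c * s) ^ p) * F ((c * s) ^ p) with hC_def
    have hbound : ∀ r, X ≤ r → (∫⁻ s in Ioc 0 t \ B r,
        ENNReal.ofReal ((c * s) ^ p) * F (r * (c * s) ^ p)) / F r ≤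
        ENNReal.ofReal (r ^ (-(1 / p)) * (2 / (X * (F X).toReal))) * C := by
      intro r hr
      have hr0 : 0 < r := hX0.trans_le hr
      have hr1 : 1 ≤ r := hX1.trans hr
      have hsub : Ioc 0 t \ B r ⊆ Ioc 0 (r ^ (-(1 / p)) * S) := by
        rintro s ⟨⟨hs0, -⟩, hsB⟩
        refine ⟨hs0, ?_⟩
        have h1 : r * (c * s) ^ p ≤ X := (not_le.1 hsB).le
        rw [← le_div_iff₀' hr0] at h1
        have h2 := Real.rpow_le_rpow (by positivity) h1 (one_div_pos.2 hp).le
        rw [← Real.rpow_mul (by positivity), mul_one_div_cancel hp.ne', Real.rpow_one,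
          Real.div_rpow hX0.le hr0.le] at h2
        rw [hS_def, Real.rpow_neg hr0.le, ← mul_div_assoc, le_div_iff₀' hc, inv_mul_eq_div]
        exact h2
      have hscale : ∀ s ∈ Ioc 0 S, ENNReal.ofReal ((c * (r ^ (-(1 / p)) * s)) ^ p) *
          F (r * (c * (r ^ (-(1 / p)) * s)) ^ p) =
          ENNReal.ofReal r⁻¹ * (ENNReal.ofReal ((c * s) ^ p) * F ((c * s) ^ p)) := by
        intro s hs
        have hs0 : 0 < s := hs.1
        have h1 : (c * (r ^ (-(1 / p)) * s)) ^ p = r⁻¹ * (c * s) ^ p := by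
          rw [mul_left_comm, Real.mul_rpow (by positivity) (by positivity),
            ← Real.rpow_mul hr0.le, neg_mul, one_div_mul_cancel hp.ne', Real.rpow_neg_one]
        rw [h1, mul_inv_cancel_left₀ hr0.ne', ENNReal.ofReal_mul (by positivity), mul_assoc]
      have hlow : ENNReal.ofReal (r⁻¹ * (X * (F X).toReal / 2)) ≤ F r := by
        rw [← ENNReal.ofReal_toReal (hfin r hr1)]
        refine ENNReal.ofReal_le_ofReal ?_
        have h1 := hpotter X r le_rfl hr
        rw [inv_mul_le_iff₀ hr0]
        have h2 : 2 * (r / X) * (F r).toReal = 2 * (r * (F r).toReal) / X := by ring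
        rw [h2, le_div_iff₀ hX0] at h1
        linarith
      have hφX := hφpos X hX1
      calc _ ≤ (∫⁻ s in Ioc 0 (r ^ (-(1 / p)) * S),
            ENNReal.ofReal ((c * s) ^ p) * F (r * (c * s) ^ p)) / F r := by
            gcongr
        _ = ENNReal.ofReal (r ^ (-(1 / p))) * (ENNReal.ofReal r⁻¹ * C) / F r := by
            rw [lintegral_Ioc_zero_mul_left _ (by positivity),
              setLIntegral_congr_fun measurableSet_Ioc hscale,
              lintegral_const_mul' _ _ ENNReal.ofReal_ne_top]
        _ ≤ ENNReal.ofReal (r ^ (-(1 / p))) * (ENNReal.ofReal r⁻¹ * C) /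
            ENNReal.ofReal (r⁻¹ * (X * (F X).toReal / 2)) := by gcongr
        _ = _ := by
            rw [← mul_assoc, ← ENNReal.ofReal_mul (by positivity), div_eq_mul_inv,
              ← ENNReal.ofReal_inv_of_pos (by positivity), mul_right_comm,
              ← ENNReal.ofReal_mul (by positivity)]
            congr 2
            field_simp
    refine tendsto_of_tendsto_of_tendsto_of_le_of_le' tendsto_const_nhds ?_
      (Eventually.of_forall fun _ => zero_le) ((eventually_ge_atTop X).mono hbound)
    have h1 : Tendsto (fun r : ℝ => r ^ (-(1 / p)) * (2 / (X * (F X).toReal))) atTop (𝓝 0) := by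
      simpa using (tendsto_rpow_neg_atTop (one_div_pos.2 hp)).mul_const
        (2 / (X * (F X).toReal))
    have h2 := ENNReal.Tendsto.mul_const (ENNReal.tendsto_ofReal h1) (Or.inr (hint S).ne)
    simpa using h2
  have hlarge : Tendsto (fun r => ∫⁻ s in Ioc 0 t, (B r).indicator
      (fun s => ENNReal.ofReal ((c * s) ^ p) * (F (r * (c * s) ^ p) / F r)) s) atTop
      (𝓝 (∫⁻ s in Ioc 0 t, ENNReal.ofReal ((c * s) ^ p))) := by
    refine tendsto_lintegral_filter_of_dominated_convergence
      (fun _ => ENNReal.ofReal (max 2 ((c * t) ^ p))) ?_ ?_ ?_ ?_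
    · exact Eventually.of_forall fun r => Measurable.indicator (by fun_prop) (hB r)
    · filter_upwards [eventually_ge_atTop X] with r hr
      have hr0 : 0 < r := hX0.trans_le hr
      have hr1 : 1 ≤ r := hX1.trans hr
      filter_upwards [ae_restrict_mem measurableSet_Ioc] with s hs
      have hs0 : 0 < s := hs.1
      have hst : s ≤ t := hs.2
      refine indicator_apply_le' (fun hsB => ?_) (fun _ => zero_le)
      have hu : 0 < (c * s) ^ p := by positivity
      have hut : (c * s) ^ p ≤ (c * t) ^ p := by gcongr
      have hsB' : X ≤ r * (c * s) ^ p := hsB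
      set u := (c * s) ^ p
      rcases le_total u 1 with hu1 | hu1
      · have h1 := hpotter (r * u) r hsB' (mul_le_of_le_one_right hr0.le hu1)
        have h2 : r / (r * u) = u⁻¹ := by field_simp
        rw [← mul_div_assoc]
        refine ENNReal.div_le_of_le_mul ?_
        rw [← ENNReal.ofReal_toReal (hfin _ (hX1.trans hsB')), ← ENNReal.ofReal_toReal (hfin r hr1),
          ← ENNReal.ofReal_mul hu.le, ← ENNReal.ofReal_mul (by positivity)]
        refine ENNReal.ofReal_le_ofReal ?_
        calc u * (F (r * u)).toReal ≤ u * (2 * u⁻¹ * (F r).toReal) := by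
              rw [← h2]
              gcongr
          _ = 2 * (F r).toReal := by field_simp
          _ ≤ max 2 ((c * t) ^ p) * (F r).toReal := by
              gcongr
              exact le_max_left _ _
      · have h1 : F (r * u) / F r ≤ 1 :=
          ENNReal.div_le_of_le_mul (by
            rw [one_mul]
            exact hanti r (r * u) hr0 (le_mul_of_one_le_right hr0.le hu1))
        calc ENNReal.ofReal u * (F (r * u) / F r) ≤ ENNReal.ofReal u * 1 := by gcongr
          _ ≤ ENNReal.ofReal (max 2 ((c * t) ^ p)) := by
              rw [mul_one]
              exact ENNReal.ofReal_le_ofReal (hut.trans (le_max_right _ _))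
    · rw [setLIntegral_const, Real.volume_Ioc]
      finiteness
    · filter_upwards [ae_restrict_mem measurableSet_Ioc] with s hs
      have hs0 : 0 < s := hs.1
      have hu : 0 < (c * s) ^ p := by positivity
      have h1 : Tendsto (fun r => ENNReal.ofReal ((c * s) ^ p) * ENNReal.ofReal
          ((F ((c * s) ^ p * r)).toReal / (F r).toReal)) atTop
          (𝓝 (ENNReal.ofReal ((c * s) ^ p))) := by
        have := ENNReal.Tendsto.const_mul (a := ENNReal.ofReal ((c * s) ^ p))
          (ENNReal.tendsto_ofReal (hsv _ hu)) (Or.inr ENNReal.ofReal_ne_top)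
        simpa using this
      refine h1.congr' ?_
      filter_upwards [(tendsto_id.const_mul_atTop hu).eventually_ge_atTop X,
        eventually_ge_atTop 1] with r hr hr1
      have hr' : X ≤ r * (c * s) ^ p := by
        rw [mul_comm]
        exact hr
      rw [indicator_of_mem (show s ∈ B r from hr'), ENNReal.ofReal_div_of_pos (hφpos r hr1),
        ENNReal.ofReal_toReal (hfin r hr1), mul_comm _ r,
        ENNReal.ofReal_toReal (hfin _ (hX1.trans hr'))]
  simp_rw [hsplit]
  simpa using hlarge.add hsmall

theorem lintegral_ofReal_mul_rpow {c p t : ℝ} (hc : 0 ≤ c) (hp : 0 < p) (ht : 0 ≤ t) :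
    ∫⁻ s in Ioc 0 t, ENNReal.ofReal ((c * s) ^ p) =
      ENNReal.ofReal (c ^ p * (t ^ (p + 1) / (p + 1))) := by
  rw [← ofReal_integral_eq_lintegral_ofReal]
  · rw [setIntegral_congr_fun measurableSet_Ioc fun s hs => Real.mul_rpow hc hs.1.le,
      ← intervalIntegral.integral_of_le ht, intervalIntegral.integral_const_mul,
      integral_rpow (Or.inl (by linarith)), Real.zero_rpow (by linarith), sub_zero]
  · refine Continuous.integrableOn_Ioc ?_
    exact (continuous_const.mul continuous_id).rpow_const fun _ => Or.inr hp.le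
  · filter_upwards [ae_restrict_mem measurableSet_Ioc] with s hs
    exact Real.rpow_nonneg (mul_nonneg hc hs.1.le) _

theorem logMoment_eq_lintegral_of_tail_eq {lam : Measure ℝ} {p r : ℝ} {ℓ : ℝ → ℝ} (hp : 0 < p)
    (hr : 1 ≤ r) (hpos : ∀ x ≥ (1 : ℝ), 0 < ℓ x)
    (htail : ∀ x ≥ (1 : ℝ), lam (Ioi x) = ENNReal.ofReal (ℓ x)) :
    logMoment lam p r = ENNReal.ofReal p *
      ∫⁻ y in Ioi (1 : ℝ), ENNReal.ofReal (ℓ (r * y) / y * Real.log y ^ (p - 1)) := by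
  have himage : Real.exp '' Ioi 0 = Ioi 1 := by
    simp
  rw [logMoment_eq_lintegral_tail lam hp (by linarith), ← himage,
    lintegral_image_eq_lintegral_abs_deriv_mul measurableSet_Ioi
      (fun x _ => (Real.hasDerivAt_exp x).hasDerivWithinAt) Real.exp_injective.injOn]
  congr 1
  refine setLIntegral_congr_fun measurableSet_Ioi fun x hx => ?_
  have hx' : 0 < x := hx
  have h1 : 1 ≤ r * Real.exp x :=
    one_le_mul_of_one_le_of_one_le hr (Real.one_le_exp hx'.le)
  have h2 := hpos _ h1
  have h3 := Real.exp_pos x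
  rw [htail _ h1, ← ENNReal.ofReal_mul h2.le, ← ENNReal.ofReal_mul (abs_nonneg _), Real.log_exp,
    abs_of_pos h3]
  congr 1
  field_simp

theorem tail_integrand_nonneg {p r : ℝ} {ℓ : ℝ → ℝ} (hr : 1 ≤ r)
    (hpos : ∀ x ≥ (1 : ℝ), 0 < ℓ x) {y : ℝ} (hy : 1 < y) :
    0 ≤ ℓ (r * y) / y * Real.log y ^ (p - 1) := by
  have h1 := hpos (r * y) (one_le_mul_of_one_le_of_one_le hr hy.le)
  have h2 := Real.log_nonneg hy.le
  have h3 : 0 < y := one_pos.trans hy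
  positivity

theorem integrableOn_of_tail_eq {lam : Measure ℝ} {p r : ℝ} {ℓ : ℝ → ℝ} (hp : 0 < p)
    (hr : 1 ≤ r) (hmeas : Measurable ℓ) (hpos : ∀ x ≥ (1 : ℝ), 0 < ℓ x)
    (htail : ∀ x ≥ (1 : ℝ), lam (Ioi x) = ENNReal.ofReal (ℓ x)) (hfin : logMoment lam p r < ⊤) :
    IntegrableOn (fun y => ℓ (r * y) / y * Real.log y ^ (p - 1)) (Ioi (1 : ℝ)) := by
  refine ⟨Measurable.aestronglyMeasurable (by fun_prop), ?_⟩
  rw [hasFiniteIntegral_iff_ofReal]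
  · rw [logMoment_eq_lintegral_of_tail_eq hp hr hpos htail] at hfin
    exact ENNReal.lt_top_of_mul_ne_top_right hfin.ne (ENNReal.ofReal_pos.2 hp).ne'
  · filter_upwards [ae_restrict_mem measurableSet_Ioi] with y hy
    exact tail_integrand_nonneg hr hpos hy

theorem toReal_logMoment_eq {lam : Measure ℝ} {p r : ℝ} {ℓ : ℝ → ℝ} (hp : 0 < p)
    (hr : 1 ≤ r) (hmeas : Measurable ℓ) (hpos : ∀ x ≥ (1 : ℝ), 0 < ℓ x)
    (htail : ∀ x ≥ (1 : ℝ), lam (Ioi x) = ENNReal.ofReal (ℓ x)) :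
    (logMoment lam p r).toReal =
      p * ∫ y in Ioi (1 : ℝ), ℓ (r * y) / y * Real.log y ^ (p - 1) := by
  rw [logMoment_eq_lintegral_of_tail_eq hp hr hpos htail, ENNReal.toReal_mul,
    ENNReal.toReal_ofReal hp.le, integral_eq_lintegral_of_nonneg_ae _
    (Measurable.aestronglyMeasurable (by fun_prop))]
  filter_upwards [ae_restrict_mem measurableSet_Ioi] with y hy
  exact tail_integrand_nonneg hr hpos hy

theorem tendsto_integral_log_rpow_div {p : ℝ} {ℓ : ℝ → ℝ} (hℓ : SlowlyVarying ℓ)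
    (hint : ∀ r ≥ (1 : ℝ),
      IntegrableOn (fun y => ℓ (r * y) / y * Real.log y ^ (p - 1)) (Ioi (1 : ℝ)))
    (hpos : ∀ r ≥ (1 : ℝ), 0 < ∫ y in Ioi (1 : ℝ), ℓ (r * y) / y * Real.log y ^ (p - 1)) :
    ∀ c > (0 : ℝ), Tendsto
      (fun x => (∫ y in Ioi (1 : ℝ), ℓ (c * x * y) / y * Real.log y ^ (p - 1)) /
        ∫ y in Ioi (1 : ℝ), ℓ (x * y) / y * Real.log y ^ (p - 1)) atTop (𝓝 1) := by
  intro c hc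
  refine Metric.tendsto_nhds.2 fun ε hε => ?_
  obtain ⟨R, hR⟩ := eventually_atTop.1
    (Metric.tendsto_nhds.1 (hℓ.2.2 c hc) (ε / 2) (half_pos hε))
  filter_upwards [eventually_ge_atTop 1, eventually_ge_atTop (1 / c), eventually_ge_atTop R]
    with x hx hxc hxR
  have hcx : 1 ≤ c * x := (div_le_iff₀' hc).1 hxc
  have hLx := hpos x hx
  rw [Real.dist_eq, div_sub_one hLx.ne', abs_div, abs_of_pos hLx, div_lt_iff₀ hLx,
    ← integral_sub (hint _ hcx) (hint _ hx)]
  refine lt_of_le_of_lt ?_ (mul_lt_mul_of_pos_right (half_lt_self hε) hLx)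
  rw [← Real.norm_eq_abs, ← integral_const_mul]
  refine norm_integral_le_of_norm_le ((hint x hx).const_mul _) ?_
  filter_upwards [ae_restrict_mem measurableSet_Ioi] with y hy
  have hy1 : 1 < y := hy
  have hy0 : 0 < y := one_pos.trans hy1
  have hℓxy := hℓ.2.1 (x * y) (one_le_mul_of_one_le_of_one_le hx hy1.le)
  have hlog := Real.log_nonneg hy1.le
  have h1 := hR (x * y) (hxR.trans (le_mul_of_one_le_right (by linarith) hy1.le))
  rw [Real.dist_eq, div_sub_one hℓxy.ne', abs_div, abs_of_pos hℓxy, div_lt_iff₀ hℓxy] at h1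
  rw [← sub_mul, ← sub_div, Real.norm_eq_abs, abs_mul, abs_div, abs_of_pos hy0,
    abs_of_nonneg (Real.rpow_nonneg hlog _), mul_assoc c x y, ← mul_assoc (ε / 2), ← mul_div_assoc]
  gcongr

theorem ConditionE.lintegral_Ioc_rpow_lt_top {d : ℕ} {lam : Measure ℝ} (hE : ConditionE d lam)
    (hd : 1 ≤ d) (hlam : IsLevyMeasure lam) :
    ∫⁻ z in Ioc (0 : ℝ) 1, ENNReal.ofReal (z ^ (1 + 1 / ((d : ℝ) / 2))) ∂lam < ⊤ := by
  have hd0 : (0 : ℝ) < d := by positivity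
  rw [one_div_div]
  rcases le_or_gt 3 d with h3 | h3
  · exact hE.2.2.2 h3
  · refine lt_of_le_of_lt ?_ hlam.2.2
    refine (setLIntegral_mono' measurableSet_Ioc fun z hz => ?_).trans
      (lintegral_mono_set Ioc_subset_Ioi_self)
    have hz0 : 0 < z := hz.1
    refine ENNReal.ofReal_le_ofReal (le_min ?_ ?_)
    · exact Real.rpow_le_one hz0.le hz.2 (by positivity)
    · rw [← Real.rpow_two]
      refine Real.rpow_le_rpow_of_exponent_ge hz0 hz.2 ?_
      have hd2 : (d : ℝ) ≤ 2 := by exact_mod_cast Nat.lt_succ_iff.1 h3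
      have := (one_le_div hd0).2 hd2
      linarith

/-- Lemma 2.2 (iii): if `λ̄(r) = ℓ(r)` is slowly varying, then with
`L₀(r) = ∫_1^∞ ℓ(ry) y^{-1} (log y)^{d/2-1} dy`, the function `L₀` is finite on `[1,∞)`,
slowly varying, `L₀(r)/ℓ(r) → ∞`, and
`η̄(r) ~ L₀(r) D^{1+2/d} / (2πκ Γ(d/2+1)(1+2/d))` as `r → ∞`. -/
theorem stmt_6 (d : ℕ) (hd : 1 ≤ d) (κ t : ℝ) (hκ : 0 < κ) (ht : 0 < t)
    (lam : Measure ℝ) (hlam : IsLevyMeasure lam) (hE : ConditionE d lam)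
    (ℓ : ℝ → ℝ) (hℓ : SlowlyVarying ℓ)
    (hrep : ∀ r ≥ (1 : ℝ), (lam (Set.Ioi r)).toReal = ℓ r)
    (D : ℝ) (hD : D = (2 * π * κ * t) ^ ((d : ℝ) / 2))
    (L₀ : ℝ → ℝ)
    (hL₀ : ∀ r : ℝ, L₀ r =
      ∫ y in Set.Ioi (1 : ℝ), ℓ (r * y) / y * Real.log y ^ ((d : ℝ) / 2 - 1)) :
    (∀ r ≥ (1 : ℝ), IntegrableOn
        (fun y => ℓ (r * y) / y * Real.log y ^ ((d : ℝ) / 2 - 1)) (Set.Ioi (1 : ℝ))) ∧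
    (∀ c > (0 : ℝ), Tendsto (fun x => L₀ (c * x) / L₀ x) atTop (𝓝 1)) ∧
    Tendsto (fun r => L₀ r / ℓ r) atTop atTop ∧
    Tendsto (fun r : ℝ =>
        (etaBar d κ t lam r).toReal /
          (L₀ r * (D ^ (1 + 2 / (d : ℝ)) /
            (2 * π * κ * Real.Gamma ((d : ℝ) / 2 + 1) * (1 + 2 / (d : ℝ))))))
      atTop (𝓝 1) := by
  have hp : 0 < (d : ℝ) / 2 := by positivity
  have hc : 0 < 2 * π * κ := by positivity
  have hσ : SigmaFinite lam := hlam.sigmaFinite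
  have htail1 : lam (Ioi 1) < ⊤ := hlam.measure_Ioi_lt_top one_pos
  have htail : ∀ r ≥ (1 : ℝ), lam (Ioi r) = ENNReal.ofReal (ℓ r) := fun r hr => by
    rw [← hrep r hr, ENNReal.ofReal_toReal (hlam.measure_Ioi_lt_top (by linarith)).ne]
  have hone : logMoment lam ((d : ℝ) / 2) 1 < ⊤ := logMoment_one_lt_top hd hE
  have hanti : ∀ a b, 0 < a → a ≤ b →
      logMoment lam ((d : ℝ) / 2) b ≤ logMoment lam ((d : ℝ) / 2) a :=
    fun a b ha hab => logMoment_le_of_le lam hp.le ha hab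
  have hfin : ∀ r ≥ (1 : ℝ), logMoment lam ((d : ℝ) / 2) r < ⊤ :=
    fun r hr => (hanti 1 r one_pos hr).trans_lt hone
  have hint : ∀ r ≥ (1 : ℝ), IntegrableOn
      (fun y => ℓ (r * y) / y * Real.log y ^ ((d : ℝ) / 2 - 1)) (Ioi (1 : ℝ)) := fun r hr =>
    integrableOn_of_tail_eq hp hr hℓ.1 hℓ.2.1 htail (hfin r hr)
  have hL : ∀ r ≥ (1 : ℝ), (logMoment lam ((d : ℝ) / 2) r).toReal = (d : ℝ) / 2 * L₀ r :=
    fun r hr => by rw [hL₀, toReal_logMoment_eq hp hr hℓ.1 hℓ.2.1 htail]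
  have hlower : ∀ r ≥ (1 : ℝ), ∀ M ≥ (1 : ℝ),
      Real.log M ^ ((d : ℝ) / 2) * ℓ (r * M) ≤ (d : ℝ) / 2 * L₀ r := by
    intro r hr M hM
    have h := mul_measure_Ioi_le_logMoment lam hp.le (by linarith : 0 < r) hM
    have hrM : 1 ≤ r * M := one_le_mul_of_one_le_of_one_le hr hM
    have hlog := Real.log_nonneg hM
    rw [htail _ hrM, ← ENNReal.ofReal_mul (by positivity)] at h
    rw [← hL r hr]
    exact (ENNReal.ofReal_le_iff_le_toReal (hfin r hr).ne).1 h
  have hLpos : ∀ r ≥ (1 : ℝ), 0 < L₀ r := by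
    intro r hr
    have h := hlower r hr (Real.exp 1) (Real.one_le_exp zero_le_one)
    have hℓpos := hℓ.2.1 (r * Real.exp 1)
      (one_le_mul_of_one_le_of_one_le hr (Real.one_le_exp zero_le_one))
    rw [Real.log_exp, Real.one_rpow, one_mul] at h
    exact pos_of_mul_pos_right (hℓpos.trans_le h) hp.le
  have hLsv : ∀ c > (0 : ℝ), Tendsto (fun x => L₀ (c * x) / L₀ x) atTop (𝓝 1) := by
    have hL₀' : L₀ = fun r =>
        ∫ y in Ioi (1 : ℝ), ℓ (r * y) / y * Real.log y ^ ((d : ℝ) / 2 - 1) := funext hL₀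
    rw [hL₀'] at hLpos ⊢
    exact tendsto_integral_log_rpow_div hℓ hint hLpos
  refine ⟨hint, hLsv, ?_, ?_⟩
  · refine tendsto_atTop.2 fun b => ?_
    have hM : Tendsto (fun M : ℝ => Real.log M ^ ((d : ℝ) / 2)) atTop atTop :=
      (tendsto_rpow_atTop hp).comp Real.tendsto_log_atTop
    obtain ⟨M, hM1, hMb⟩ := ((eventually_ge_atTop 1).and
      (hM.eventually_ge_atTop ((d : ℝ) / 2 * (|b| * 2)))).exists
    filter_upwards [eventually_ge_atTop 1, (hℓ.2.2 M (by linarith)).eventually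
      (lt_mem_nhds (by norm_num : (1 / 2 : ℝ) < 1))] with r hr hrM
    have hℓr := hℓ.2.1 r hr
    have h := hlower r hr M hM1
    rw [lt_div_iff₀ hℓr, mul_comm M r] at hrM
    rw [le_div_iff₀ hℓr]
    have h1 : (d : ℝ) / 2 * (|b| * 2) * (1 / 2 * ℓ r) ≤ (d : ℝ) / 2 * L₀ r :=
      (mul_le_mul hMb hrM.le (by positivity)
        (Real.rpow_nonneg (Real.log_nonneg hM1) _)).trans h
    have h2 : (d : ℝ) / 2 * (|b| * ℓ r) ≤ (d : ℝ) / 2 * L₀ r := by linarith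
    exact (mul_le_mul_of_nonneg_right (le_abs_self b) hℓr.le).trans (le_of_mul_le_mul_left h2 hp)
  · have hsmall := hE.lintegral_Ioc_rpow_lt_top hd hlam
    have hkar := tendsto_lintegral_rpow_mul_div (t := t) hc hp (measurable_logMoment lam _) hanti
      hone (fun x hx h0 => by
        have := hL x hx
        rw [h0, ENNReal.toReal_zero] at this
        exact (mul_pos hp (hLpos x hx)).ne this)
      (fun k hk => (hLsv k hk).congr' (by
        filter_upwards [eventually_ge_atTop 1, eventually_ge_atTop (1 / k)] with x hx hxk
        rw [hL x hx, hL (k * x) ((div_le_iff₀' hk).1 hxk), mul_div_mul_left _ _ hp.ne']))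
      (lintegral_mul_logMoment_lt_top hc hp hsmall hE.1 htail1)
    rw [lintegral_ofReal_mul_rpow hc.le hp ht.le] at hkar
    have hreal := (ENNReal.tendsto_toReal ENNReal.ofReal_ne_top).comp hkar
    rw [ENNReal.toReal_ofReal (by positivity)] at hreal
    set K := (2 * π * κ) ^ ((d : ℝ) / 2) * (t ^ ((d : ℝ) / 2 + 1) / ((d : ℝ) / 2 + 1)) with hK_def
    have hK : 0 < K := by positivity
    have hG : 0 < Real.Gamma ((d : ℝ) / 2 + 1) := Real.Gamma_pos_of_pos (by positivity)
    have hconst : D ^ (1 + 2 / (d : ℝ)) /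
        (2 * π * κ * Real.Gamma ((d : ℝ) / 2 + 1) * (1 + 2 / (d : ℝ))) =
        (d : ℝ) / 2 * K / Real.Gamma ((d : ℝ) / 2 + 1) := by
      have hd0 : (0 : ℝ) < d := by positivity
      have hexp : (d : ℝ) / 2 * (1 + 2 / (d : ℝ)) = (d : ℝ) / 2 + 1 := by field_simp
      have hDpow : D ^ (1 + 2 / (d : ℝ)) =
          (2 * π * κ) ^ ((d : ℝ) / 2) * (2 * π * κ) * t ^ ((d : ℝ) / 2 + 1) := by
        rw [hD, ← Real.rpow_mul (by positivity), hexp, Real.mul_rpow hc.le ht.le,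
          Real.rpow_add_one hc.ne']
      rw [hDpow, hK_def]
      field_simp
    rw [hconst]
    have hlim := hreal.div_const K
    rw [div_self hK.ne'] at hlim
    refine hlim.congr' ?_
    filter_upwards [eventually_ge_atTop 1] with r hr
    have hLr := hLpos r hr
    rw [Function.comp_apply, ENNReal.toReal_div, hL r hr, etaBar_eq hd hκ (by linarith),
      ENNReal.toReal_mul, ENNReal.toReal_ofReal (one_div_pos.2 hG).le]
    generalize (∫⁻ s in Ioc 0 t, _ : ℝ≥0∞).toReal = I
    field_simp
end
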